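/- Let G₀ = ℤ/3 ⋆ ℤ/3 with canonical generators a and b (each of order 3). Then the subgroup H of G₀ generated by {ab², b²a} has index 3 in G₀, and {ab², b²a} is a free basis of H, i.e., the homomorphism from the free group on two generators to G₀ sending the two generators to ab² and b²a is injective with range equal to H. -/

import Mathlib

/-- The free product ℤ/3 ⋆ ℤ/3. -/
abbrev G₀ : Type :=
  Monoid.Coprod (Multiplicative (ZMod 3)) (Multiplicative (ZMod 3))

/-- The canonical generator `a` of the first factor (of order 3). -/
def genA : G₀ := Monoid.Coprod.inl (Multiplicative.ofAdd 1)

/-- The canonical generator `b` of the second factor (of order 3). -/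
def genB : G₀ := Monoid.Coprod.inr (Multiplicative.ofAdd 1)

/-- The homomorphism from the cyclic group of order `n` sending the generator to `g`. -/
def zmodPowHom {G : Type*} [Group G] (n : ℕ) [NeZero n] (g : G) (hg : g ^ n = 1) :
    Multiplicative (ZMod n) →* G :=
  MonoidHom.mk' (fun k => g ^ k.toAdd.val) fun k l => by
    rw [toAdd_mul, ZMod.val_add, ← pow_add, ← pow_eq_pow_mod _ hg]

theorem zmodPowHom_ofAdd_one {G : Type*} [Group G] (g : G) (hg : g ^ 3 = 1) :
    zmodPowHom 3 g hg (Multiplicative.ofAdd 1) = g :=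
  pow_one g

theorem eq_ofAdd_one_pow_val (k : Multiplicative (ZMod 3)) :
    k = Multiplicative.ofAdd 1 ^ k.toAdd.val := by
  revert k
  decide

theorem zmod_three_hom_ext {M : Type*} [Monoid M] {f g : Multiplicative (ZMod 3) →* M}
    (h : f (Multiplicative.ofAdd 1) = g (Multiplicative.ofAdd 1)) : f = g := by
  refine MonoidHom.ext fun k => ?_
  rw [eq_ofAdd_one_pow_val k, map_pow, map_pow, h]

/-- The endomorphism `x ↦ x⁻¹y⁻¹`, `y ↦ x` of the free group on `x`, `y`. -/
def rotEnd : FreeGroup (Fin 2) →* FreeGroup (Fin 2) :=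
  FreeGroup.lift ![(FreeGroup.of 0)⁻¹ * (FreeGroup.of 1)⁻¹, FreeGroup.of 0]

theorem rotEnd_of_zero :
    rotEnd (FreeGroup.of 0) = (FreeGroup.of 0)⁻¹ * (FreeGroup.of 1)⁻¹ := by
  simp [rotEnd]

theorem rotEnd_of_one : rotEnd (FreeGroup.of 1) = FreeGroup.of 0 := by
  simp [rotEnd]

theorem rotEnd_comp_comp : (rotEnd.comp rotEnd).comp rotEnd = MonoidHom.id _ := by
  ext i
  fin_cases i <;> simp [rotEnd_of_zero, rotEnd_of_one]

/-- `rotEnd` as an automorphism. -/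
def rotAut : MulAut (FreeGroup (Fin 2)) :=
  rotEnd.toMulEquiv (rotEnd.comp rotEnd) rotEnd_comp_comp rotEnd_comp_comp

theorem rotAut_apply (w : FreeGroup (Fin 2)) : rotAut w = rotEnd w := rfl

theorem rotAut_pow_three : rotAut ^ 3 = 1 := by
  ext1 w
  exact DFunLike.congr_fun rotEnd_comp_comp w

/-- The action of the cyclic group of order three on the free group of rank two by `rotAut`. -/
def rotAction : Multiplicative (ZMod 3) →* MulAut (FreeGroup (Fin 2)) :=
  zmodPowHom 3 rotAut rotAut_pow_three

theorem rotAction_ofAdd_one : rotAction (Multiplicative.ofAdd 1) = rotAut :=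
  zmodPowHom_ofAdd_one _ _

/-- The semidirect product of the free group of rank two with the cyclic group of order three. -/
abbrev RotProd : Type := FreeGroup (Fin 2) ⋊[rotAction] Multiplicative (ZMod 3)

theorem rotProd_pow_three :
    (⟨FreeGroup.of 0, Multiplicative.ofAdd 1⟩ : RotProd) ^ 3 = 1 := by
  rw [pow_three]
  ext1
  · simp [rotAction_ofAdd_one, rotAut_apply, rotEnd_of_zero, rotEnd_of_one]
  · simp only [SemidirectProduct.mul_right, SemidirectProduct.one_right]
    decide

/-- The homomorphism `a ↦ (x, t)`, `b ↦ (1, t)` from the free product to the semidirect product. -/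
def toRotProd : G₀ →* RotProd :=
  Monoid.Coprod.lift (zmodPowHom 3 _ rotProd_pow_three) SemidirectProduct.inr

theorem toRotProd_genA : toRotProd genA = ⟨FreeGroup.of 0, Multiplicative.ofAdd 1⟩ := by
  rw [toRotProd, genA, Monoid.Coprod.lift_apply_inl, zmodPowHom_ofAdd_one]

theorem toRotProd_genB : toRotProd genB = SemidirectProduct.inr (Multiplicative.ofAdd 1) := by
  rw [toRotProd, genB, Monoid.Coprod.lift_apply_inr]

theorem genA_pow_three : genA ^ 3 = 1 := by
  rw [genA, ← map_pow, ← map_one Monoid.Coprod.inl]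
  congr 1

theorem genB_pow_three : genB ^ 3 = 1 := by
  rw [genB, ← map_pow, ← map_one Monoid.Coprod.inr]
  congr 1

theorem genB_sq : genB ^ 2 = genB⁻¹ :=
  eq_inv_of_mul_eq_one_left (by rw [← pow_succ, genB_pow_three])

/-- The homomorphism from the free group of rank two to `G₀` with `x ↦ ab²` and `y ↦ b²a`. -/
def freeToG₀ : FreeGroup (Fin 2) →* G₀ :=
  FreeGroup.lift ![genA * genB ^ 2, genB ^ 2 * genA]

theorem freeToG₀_of_zero : freeToG₀ (FreeGroup.of 0) = genA * genB ^ 2 := by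
  simp [freeToG₀]

theorem freeToG₀_of_one : freeToG₀ (FreeGroup.of 1) = genB ^ 2 * genA := by
  simp [freeToG₀]

theorem range_freeToG₀ :
    freeToG₀.range = Subgroup.closure {genA * genB ^ 2, genB ^ 2 * genA} := by
  rw [freeToG₀, FreeGroup.range_lift_eq_closure, Matrix.range_cons, Matrix.range_cons,
    Matrix.range_empty, Set.union_empty, Set.singleton_union]

theorem toRotProd_comp_freeToG₀ : toRotProd.comp freeToG₀ = SemidirectProduct.inl := by
  have hA : toRotProd genA =
      SemidirectProduct.inl (FreeGroup.of 0) * SemidirectProduct.inr (Multiplicative.ofAdd 1) := by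
    rw [toRotProd_genA, SemidirectProduct.mk_eq_inl_mul_inr]
  have hy : (SemidirectProduct.inl (FreeGroup.of 0) : RotProd) =
      SemidirectProduct.inr (Multiplicative.ofAdd 1) * SemidirectProduct.inl (FreeGroup.of 1) *
        SemidirectProduct.inr (Multiplicative.ofAdd 1)⁻¹ := by
    rw [← SemidirectProduct.inl_aut, rotAction_ofAdd_one, rotAut_apply, rotEnd_of_one]
  ext1 i
  fin_cases i
  · simp [freeToG₀_of_zero, genB_sq, hA, toRotProd_genB]
  · simp [freeToG₀_of_one, genB_sq, hA, toRotProd_genB, hy, mul_assoc]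

theorem freeToG₀_injective : Function.Injective freeToG₀ := by
  have h : Function.Injective (toRotProd ∘ freeToG₀) := by
    rw [← MonoidHom.coe_comp, toRotProd_comp_freeToG₀]
    exact SemidirectProduct.inl_injective
  exact h.of_comp

theorem freeToG₀_rotEnd (w : FreeGroup (Fin 2)) :
    freeToG₀ (rotEnd w) = genB * freeToG₀ w * genB⁻¹ := by
  have h : freeToG₀.comp rotEnd = (MulAut.conj genB).toMonoidHom.comp freeToG₀ := by
    have hA : genA⁻¹ = genA * genA :=
      inv_eq_of_mul_eq_one_left (by rw [← pow_three', genA_pow_three])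
    have hB : genB⁻¹ * genB⁻¹ = genB := by
      rw [← genB_sq, ← pow_add, pow_succ, genB_pow_three, one_mul]
    ext1 i
    fin_cases i
    · have : genB * genA⁻¹ * (genA⁻¹ * genB) = genB * genA * genB⁻¹ * genB⁻¹ := by
        rw [mul_assoc _ genB⁻¹, hB, hA]
        have := genA_pow_three
        rw [pow_three] at this
        simp only [mul_assoc]
        rw [← mul_assoc genA genA (genA * _), ← mul_assoc (genA * genA) genA, mul_assoc genA genA,
          this, one_mul]
      simpa [freeToG₀_of_zero, freeToG₀_of_one, rotEnd_of_zero, genB_sq, mul_assoc] using this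
    · simp [freeToG₀_of_zero, freeToG₀_of_one, rotEnd_of_one, genB_sq]
  exact DFunLike.congr_fun h w

/-- The inverse of `toRotProd`. -/
def ofRotProd : RotProd →* G₀ :=
  SemidirectProduct.lift freeToG₀ Monoid.Coprod.inr fun k => by
    rw [eq_ofAdd_one_pow_val k]
    generalize k.toAdd.val = m
    induction m with
    | zero => ext1; simp
    | succ m ih =>
      ext1 i
      have h := DFunLike.congr_fun ih (rotEnd (FreeGroup.of i))
      simp only [MonoidHom.comp_apply, MulEquiv.coe_toMonoidHom, MulAut.conj_apply] at h ⊢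
      rw [pow_succ, map_mul rotAction, MulAut.mul_apply, rotAction_ofAdd_one, rotAut_apply, h,
        freeToG₀_rotEnd, map_mul Monoid.Coprod.inr, mul_inv_rev]
      simp only [mul_assoc, genB]

theorem ofRotProd_comp_toRotProd : ofRotProd.comp toRotProd = MonoidHom.id G₀ := by
  refine Monoid.Coprod.hom_ext (zmod_three_hom_ext ?_) (zmod_three_hom_ext ?_)
  · change ofRotProd (toRotProd genA) = genA
    rw [toRotProd_genA, SemidirectProduct.mk_eq_inl_mul_inr, map_mul, ofRotProd,
      SemidirectProduct.lift_inl, SemidirectProduct.lift_inr, freeToG₀_of_zero, genB_sq]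
    exact inv_mul_cancel_right genA genB
  · change ofRotProd (toRotProd genB) = genB
    rw [toRotProd_genB, ofRotProd, SemidirectProduct.lift_inr, genB]

theorem range_freeToG₀_eq_ker :
    freeToG₀.range = (SemidirectProduct.rightHom.comp toRotProd).ker := by
  ext g
  constructor
  · rintro ⟨w, rfl⟩
    have h := DFunLike.congr_fun toRotProd_comp_freeToG₀ w
    rw [MonoidHom.comp_apply] at h
    rw [MonoidHom.mem_ker, MonoidHom.comp_apply, h, SemidirectProduct.rightHom_inl]
  · intro hg
    rw [MonoidHom.mem_ker, MonoidHom.comp_apply, ← MonoidHom.mem_ker,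
      ← SemidirectProduct.range_inl_eq_ker_rightHom] at hg
    obtain ⟨w, hw⟩ := hg
    refine ⟨w, ?_⟩
    have h := DFunLike.congr_fun ofRotProd_comp_toRotProd g
    rw [MonoidHom.comp_apply, ← hw, ofRotProd, SemidirectProduct.lift_inl] at h
    exact h

theorem index_range_freeToG₀ : freeToG₀.range.index = 3 := by
  have hsurj : Function.Surjective (SemidirectProduct.rightHom.comp toRotProd) := fun k =>
    ⟨Monoid.Coprod.inr k, by simp [toRotProd]⟩
  rw [range_freeToG₀_eq_ker, Subgroup.index_ker, MonoidHom.range_eq_top.mpr hsurj,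
    Subgroup.card_top]
  exact Nat.card_zmod 3

theorem stmt_18 (a b : G₀) (ha : a = genA) (hb : b = genB)
    (H : Subgroup G₀) (hH : H = Subgroup.closure {a * b ^ 2, b ^ 2 * a}) :
    H.index = 3 ∧
    ∃ φ : FreeGroup (Fin 2) →* G₀,
      φ (FreeGroup.of 0) = a * b ^ 2 ∧ φ (FreeGroup.of 1) = b ^ 2 * a ∧
      Function.Injective φ ∧ φ.range = H := by
  subst ha hb hH
  rw [← range_freeToG₀]
  exact ⟨index_range_freeToG₀, freeToG₀, freeToG₀_of_zero, freeToG₀_of_one, freeToG₀_injective, rfl⟩
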